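/- Let m ≥ 1, n ≥ 1, let A ∈ ℂ^{m×m}, and for each x ∈ Fin m let b^{(x)} : ZMod n → ℂ. Let à be the partial-circulant matrix Ã((x,c),(y,d)) = δ_{c,d}·A_{x,y} + δ_{x,y}·b^{(x)}_{d-c}, and for k ∈ ZMod n let A_k be the m×m matrix (A_k)_{x,y} = A_{x,y} + δ_{x,y}·λ_k(b^{(x)}). Then for every polynomial p ∈ ℂ[X] and all (x,c), (y,d): (p(Ã))((x,c),(y,d)) = (1/n)·Σ_{k ∈ ZMod n} e^{-2πi·k·(c-d)/n}·(p(A_k))(x,y), where p(M) denotes evaluation of the polynomial p at the square matrix M. -/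

import Mathlib

open scoped BigOperators

/-- The partial-circulant matrix
`Ã((x,c),(y,d)) = δ_{c,d}·A_{x,y} + δ_{x,y}·b^{(x)}_{d-c}`. -/
def partialCirculant {m n : ℕ} (A : Matrix (Fin m) (Fin m) ℂ) (b : Fin m → ZMod n → ℂ) :
    Matrix (Fin m × ZMod n) (Fin m × ZMod n) ℂ :=
  Matrix.of fun p q =>
    (if p.2 = q.2 then A p.1 q.1 else 0) + (if p.1 = q.1 then b p.1 (q.2 - p.2) else 0)

/-- The `k`-th Fourier eigenvalue `λ_k(b) = Σ_l b_l e^{-2πi·k·l/n}`. -/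
noncomputable def fourierEigenvalue (n : ℕ) [NeZero n] (b : ZMod n → ℂ) (k : ZMod n) : ℂ :=
  ∑ l : ZMod n, b l *
    Complex.exp (-(2 * Real.pi * Complex.I * (k.val : ℂ) * (l.val : ℂ)) / (n : ℂ))

/-- The `k`-th block `A_k`, with `(A_k)_{x,y} = A_{x,y} + δ_{x,y}·λ_k(b^{(x)})`. -/
noncomputable def blockOf {m n : ℕ} [NeZero n] (A : Matrix (Fin m) (Fin m) ℂ)
    (b : Fin m → ZMod n → ℂ) (k : ZMod n) : Matrix (Fin m) (Fin m) ℂ :=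
  Matrix.of fun x y => A x y + if x = y then fourierEigenvalue n (b x) k else 0

theorem pc_exp_eq {n : ℕ} [NeZero n] (k l : ZMod n) :
    Complex.exp (-(2 * Real.pi * Complex.I * (k.val : ℂ) * (l.val : ℂ)) / (n : ℂ)) =
      ZMod.stdAddChar (-(k * l)) := by
  have h : (-(k * l) : ZMod n) = ((-((k.val : ℤ) * (l.val : ℤ)) : ℤ) : ZMod n) := by
    push_cast
    simp
  rw [h, ZMod.stdAddChar_coe]
  congr 1
  push_cast
  ring

/-- The intertwining matrix. -/
noncomputable def pcV (m n : ℕ) [NeZero n] (k : ZMod n) :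
    Matrix (Fin m × ZMod n) (Fin m) ℂ :=
  Matrix.of fun p y => if p.1 = y then ZMod.stdAddChar (-(k * p.2)) else 0

theorem pc_mul_V {m n : ℕ} [NeZero n] (M : Matrix (Fin m × ZMod n) (Fin m × ZMod n) ℂ)
    (k : ZMod n) (x y : Fin m) (c : ZMod n) :
    (M * pcV m n k) (x, c) y = ∑ d, M (x, c) (y, d) * ZMod.stdAddChar (-(k * d)) := by
  simp only [Matrix.mul_apply, pcV, Matrix.of_apply, Fintype.sum_prod_type]
  rw [Finset.sum_eq_single y]
  · simp
  · intro z _ hz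
    simp [hz]
  · simp

theorem pc_V_mul {m n : ℕ} [NeZero n] (B : Matrix (Fin m) (Fin m) ℂ)
    (k : ZMod n) (x y : Fin m) (c : ZMod n) :
    (pcV m n k * B) (x, c) y = ZMod.stdAddChar (-(k * c)) * B x y := by
  simp [Matrix.mul_apply, pcV]

theorem pc_intertwine {m n : ℕ} [NeZero n]
    (A : Matrix (Fin m) (Fin m) ℂ) (b : Fin m → ZMod n → ℂ) (k : ZMod n) :
    partialCirculant A b * pcV m n k = pcV m n k * blockOf A b k := by
  ext ⟨x, c⟩ y
  rw [pc_mul_V, pc_V_mul]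
  simp only [partialCirculant, blockOf, Matrix.of_apply, fourierEigenvalue, pc_exp_eq,
    add_mul, mul_add, Finset.sum_add_distrib]
  congr 1
  · simp [mul_comm]
  · by_cases h : x = y
    · simp only [h, if_true, Finset.mul_sum]
      rw [← Equiv.sum_comp (Equiv.addRight c)]
      refine Finset.sum_congr rfl fun l _ => ?_
      simp only [Equiv.coe_addRight, add_sub_cancel_right]
      rw [show -(k * (l + c)) = -(k * c) + -(k * l) by ring, AddChar.map_add_eq_mul]
      ring
    · simp [h]

theorem pc_aeval_intertwine {m n : ℕ} [NeZero n]
    (A : Matrix (Fin m) (Fin m) ℂ) (b : Fin m → ZMod n → ℂ) (k : ZMod n) (p : Polynomial ℂ) :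
    Polynomial.aeval (partialCirculant A b) p * pcV m n k =
      pcV m n k * Polynomial.aeval (blockOf A b k) p := by
  induction p using Polynomial.induction_on with
  | C a => simp [Algebra.algebraMap_eq_smul_one]
  | add p q hp hq => simp [Matrix.add_mul, Matrix.mul_add, hp, hq]
  | monomial i a h =>
    rw [pow_succ, ← mul_assoc, map_mul (Polynomial.aeval (partialCirculant A b)) _ Polynomial.X,
      map_mul (Polynomial.aeval (blockOf A b k)) _ Polynomial.X,
      Polynomial.aeval_X, Polynomial.aeval_X,
      Matrix.mul_assoc, pc_intertwine, ← Matrix.mul_assoc, h, Matrix.mul_assoc]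

/-- Polynomial functions of a partial-circulant matrix are recovered from the same
polynomial functions of its blocks by the inverse discrete Fourier transform. -/
theorem partialCirculant_aeval_apply (m n : ℕ) (hm : 1 ≤ m) [NeZero n]
    (A : Matrix (Fin m) (Fin m) ℂ) (b : Fin m → ZMod n → ℂ) :
    ∀ (p : Polynomial ℂ) (x y : Fin m) (c d : ZMod n),
      (Polynomial.aeval (partialCirculant A b) p) (x, c) (y, d) =
        (1 / (n : ℂ)) * ∑ k : ZMod n,
          Complex.exp (-(2 * Real.pi * Complex.I * (k.val : ℂ) * (((c - d : ZMod n)).val : ℂ))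
              / (n : ℂ)) *
            (Polynomial.aeval (blockOf A b k) p) x y := by
  intro p x y c d
  have key : ∀ k : ZMod n,
      ZMod.stdAddChar (-(k * (c - d))) * (Polynomial.aeval (blockOf A b k) p) x y =
      ∑ e, (Polynomial.aeval (partialCirculant A b) p) (x, c) (y, e) *
        ZMod.stdAddChar (k * (d - e)) := by
    intro k
    have h := congrFun (congrFun (pc_aeval_intertwine A b k p) (x, c)) y
    rw [pc_mul_V, pc_V_mul] at h
    rw [show -(k * (c - d)) = k * d + -(k * c) by ring, AddChar.map_add_eq_mul, mul_assoc, ← h,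
      Finset.mul_sum]
    refine Finset.sum_congr rfl fun e _ => ?_
    rw [show k * (d - e) = k * d + -(k * e) by ring, AddChar.map_add_eq_mul]
    ring
  simp only [pc_exp_eq, key]
  rw [Finset.sum_comm]
  simp only [← Finset.mul_sum, AddChar.sum_mulShift _ (ZMod.isPrimitive_stdAddChar n)]
  have hn : (n : ℂ) ≠ 0 := Nat.cast_ne_zero.mpr (NeZero.ne n)
  simp only [sub_eq_zero, ZMod.card]
  rw [Finset.sum_eq_single d]
  · simp
    field_simp
  · intro e _ he
    simp [Ne.symm he]
  · simp
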